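/- Let n, m, n', m' be positive integers with n + m = n' + m' = N and let μ, μ' > 0. If f is a biholomorphism from the Fock–Bargmann–Hartogs domain D_{n,m}(μ) onto D_{n',m'}(μ') with f(0,0) = (0,0), then f is linear: there exists a ℂ-linear map L : ℂ^N → ℂ^N such that f(x) = L(x) for all x ∈ D_{n,m}(μ). -/

import Mathlib

/-- The Fock–Bargmann–Hartogs domain
`D_{n,m}(μ) = {(z,w) ∈ ℂ^n × ℂ^m : ‖w‖² < exp (−μ‖z‖²)}`. -/
def FBH (n m : ℕ) (μ : ℝ) :
    Set (EuclideanSpace ℂ (Fin n) × EuclideanSpace ℂ (Fin m)) :=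
  {p | ‖p.2‖ ^ 2 < Real.exp (-μ * ‖p.1‖ ^ 2)}

section Disc

variable {E F : Type*} [NormedAddCommGroup E] [InnerProductSpace ℂ E]
  [NormedAddCommGroup F] [InnerProductSpace ℂ F]

lemma disc_boundary (μ : ℝ) (hμ : 0 < μ) (a q : E) (v : F) (t : ℂ) (r : ℝ) (hr : 0 < r)
    (ht : ‖t‖ = r) (hb : ‖t • v‖ ^ 2 ≤ Real.exp (-μ * ‖t • q‖ ^ 2)) :
    ‖Complex.exp ((μ * r ^ 2 : ℝ) * inner ℂ a q) • v‖ ≤ r⁻¹ * Real.exp (μ * r ^ 2 * ‖a‖ ^ 2 / 2) := by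
  rw [norm_smul, Complex.norm_exp, Complex.re_ofReal_mul]
  rw [norm_smul, norm_smul, ht] at hb
  have h1 : 0 ≤ ‖a‖ ^ 2 - 2 * (inner ℂ a q : ℂ).re + ‖q‖ ^ 2 := by
    have := @norm_sub_sq ℂ E _ _ _ a q
    simp only [RCLike.re_eq_complex_re] at this
    rw [← this]; positivity
  have h2 : ‖v‖ ≤ r⁻¹ * Real.exp (-μ * (r * ‖q‖) ^ 2 / 2) := by
    rw [inv_mul_eq_div, le_div_iff₀ hr]
    refine le_of_sq_le_sq ?_ (Real.exp_pos _).le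
    rw [← Real.exp_nat_mul]
    have e1 : ((2 : ℕ) : ℝ) * (-μ * (r * ‖q‖) ^ 2 / 2) = -μ * (r * ‖q‖) ^ 2 := by
      push_cast; ring
    rw [e1, mul_comm]
    exact hb
  calc _ ≤ Real.exp (μ * r ^ 2 * (inner ℂ a q : ℂ).re) * (r⁻¹ * Real.exp (-μ * (r * ‖q‖) ^ 2 / 2)) := by
        gcongr
    _ = r⁻¹ * Real.exp (μ * r ^ 2 * (inner ℂ a q : ℂ).re + -μ * (r * ‖q‖) ^ 2 / 2) := by
        rw [Real.exp_add]; ring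
    _ ≤ _ := by
        gcongr
        have : 0 < μ * r ^ 2 := by positivity
        nlinarith

lemma diffOn_exp_inner {s : Set ℂ} (k : ℝ) (a : E) {q : ℂ → E} {v : ℂ → F}
    (hq : DifferentiableOn ℂ q s) (hv : DifferentiableOn ℂ v s) :
    DifferentiableOn ℂ (fun t => Complex.exp ((k : ℂ) * inner ℂ a (q t)) • v t) s := by
  have h : DifferentiableOn ℂ (fun t => innerSL ℂ a (q t)) s :=
    (innerSL ℂ a).differentiable.comp_differentiableOn hq
  exact ((h.const_mul (k : ℂ)).cexp).smul hv

lemma disc_bound (μ : ℝ) (hμ : 0 < μ) (q : ℂ → E) (v : ℂ → F)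
    (hq : DifferentiableOn ℂ q (Metric.ball 0 1)) (hv : DifferentiableOn ℂ v (Metric.ball 0 1))
    (hb : ∀ t ∈ Metric.ball (0 : ℂ) 1, ‖t • v t‖ ^ 2 ≤ Real.exp (-μ * ‖t • q t‖ ^ 2))
    (a : E) (t : ℂ) (ht : t ∈ Metric.ball (0 : ℂ) 1) :
    ‖Complex.exp ((μ : ℂ) * inner ℂ a (q t)) • v t‖ ≤ Real.exp (μ * ‖a‖ ^ 2 / 2) := by
  have ht' : ‖t‖ < 1 := by simpa using ht
  have key : ∀ r : ℝ, ‖t‖ < r → r < 1 →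
      ‖Complex.exp ((μ * r ^ 2 : ℝ) * inner ℂ a (q t)) • v t‖
        ≤ r⁻¹ * Real.exp (μ * r ^ 2 * ‖a‖ ^ 2 / 2) := by
    intro r hr hr1
    have hr0 : 0 < r := (norm_nonneg t).trans_lt hr
    have hsub : Metric.closedBall (0 : ℂ) r ⊆ Metric.ball 0 1 := Metric.closedBall_subset_ball hr1
    refine Complex.norm_le_of_forall_mem_frontier_norm_le (U := Metric.ball (0 : ℂ) r)
      (f := fun t => Complex.exp ((μ * r ^ 2 : ℝ) * inner ℂ a (q t)) • v t)
      Metric.isBounded_ball ?_ ?_ (subset_closure (by simpa using hr))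
    · refine DifferentiableOn.diffContOnCl ?_
      rw [closure_ball _ hr0.ne']
      exact (diffOn_exp_inner _ a hq hv).mono hsub
    · intro x hx
      rw [frontier_ball _ hr0.ne'] at hx
      have hx' : ‖x‖ = r := by simpa using hx
      exact disc_boundary μ hμ a (q x) (v x) x r hr0 hx' (hb x (by simp [hx', hr1]))
  have T1 : Filter.Tendsto (fun r : ℝ => ‖Complex.exp ((μ * r ^ 2 : ℝ) * inner ℂ a (q t)) • v t‖)
      (nhdsWithin 1 (Set.Iio 1)) (nhds ‖Complex.exp ((μ * 1 ^ 2 : ℝ) * inner ℂ a (q t)) • v t‖) := by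
    refine (Continuous.tendsto ?_ 1).mono_left nhdsWithin_le_nhds
    fun_prop
  have T2 : Filter.Tendsto (fun r : ℝ => r⁻¹ * Real.exp (μ * r ^ 2 * ‖a‖ ^ 2 / 2))
      (nhdsWithin 1 (Set.Iio 1)) (nhds ((1 : ℝ)⁻¹ * Real.exp (μ * 1 ^ 2 * ‖a‖ ^ 2 / 2))) := by
    refine Filter.Tendsto.mono_left ?_ nhdsWithin_le_nhds
    refine (tendsto_inv₀ one_ne_zero).mul ?_
    refine Continuous.tendsto ?_ 1
    fun_prop
  have := le_of_tendsto_of_tendsto T1 T2 (by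
    filter_upwards [Ioo_mem_nhdsLT ht'] with r hr
    exact key r hr.1 hr.2)
  simpa using this

lemma disc_zero (μ : ℝ) (hμ : 0 < μ) (q : ℂ → E) (v : ℂ → F)
    (hq : DifferentiableOn ℂ q (Metric.ball 0 1)) (hv : DifferentiableOn ℂ v (Metric.ball 0 1))
    (hb : ∀ t ∈ Metric.ball (0 : ℂ) 1, ‖t • v t‖ ^ 2 ≤ Real.exp (-μ * ‖t • q t‖ ^ 2)) :
    ‖v 0‖ ^ 2 ≤ Real.exp (-μ * ‖q 0‖ ^ 2) := by
  have h := disc_bound μ hμ q v hq hv hb (q 0) 0 (by simp)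
  rw [norm_smul, Complex.norm_exp, Complex.re_ofReal_mul, inner_self_eq_norm_sq_to_K] at h
  have e : (((‖q 0‖ : ℂ)) ^ 2).re = ‖q 0‖ ^ 2 := by
    rw [← Complex.ofReal_pow, Complex.ofReal_re]
  have h' : Real.exp (μ * ‖q 0‖ ^ 2) * ‖v 0‖ ≤ Real.exp (μ * ‖q 0‖ ^ 2 / 2) := by
    have h'' := h
    erw [e] at h''
    exact h''
  have h2 : ‖v 0‖ ≤ Real.exp (-(μ * ‖q 0‖ ^ 2 / 2)) := by
    have h3 : Real.exp (μ * ‖q 0‖ ^ 2 / 2)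
        = Real.exp (μ * ‖q 0‖ ^ 2) * Real.exp (-(μ * ‖q 0‖ ^ 2 / 2)) := by
      rw [← Real.exp_add]; congr 1; ring
    rw [h3] at h'
    exact le_of_mul_le_mul_left h' (Real.exp_pos _)
  calc ‖v 0‖ ^ 2 ≤ Real.exp (-(μ * ‖q 0‖ ^ 2 / 2)) ^ 2 := by gcongr
    _ = _ := by rw [← Real.exp_nat_mul]; congr 1; push_cast; ring

lemma disc_rigid (μ : ℝ) (hμ : 0 < μ) (q : ℂ → E) (v : ℂ → F)
    (hq : DifferentiableOn ℂ q (Metric.ball 0 1)) (hv : DifferentiableOn ℂ v (Metric.ball 0 1))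
    (hb : ∀ t ∈ Metric.ball (0 : ℂ) 1, ‖t • v t‖ ^ 2 ≤ Real.exp (-μ * ‖t • q t‖ ^ 2))
    (h0 : ‖v 0‖ ^ 2 = Real.exp (-μ * ‖q 0‖ ^ 2)) :
    ∀ t ∈ Metric.ball (0 : ℂ) 1, q t = q 0 ∧ v t = v 0 := by
  have e0 : (inner ℂ (q 0) (q 0) : ℂ) = ((‖q 0‖ ^ 2 : ℝ) : ℂ) := by
    rw [inner_self_eq_norm_sq_to_K]; push_cast; rfl
  have n0 : ‖v 0‖ = Real.exp (-(μ * ‖q 0‖ ^ 2 / 2)) := by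
    refine (sq_eq_sq₀ (norm_nonneg _) (Real.exp_pos _).le).1 ?_
    rw [h0, ← Real.exp_nat_mul]; congr 1; push_cast; ring
  let V : ℂ → F := fun t => Complex.exp ((μ : ℂ) * inner ℂ (q 0) (q t)) • v t
  have hV0 : ‖V 0‖ = Real.exp (μ * ‖q 0‖ ^ 2 / 2) := by
    simp only [V]
    rw [norm_smul, Complex.norm_exp, Complex.re_ofReal_mul, e0, Complex.ofReal_re, n0,
      ← Real.exp_add]
    congr 1; ring
  have hmax : IsMaxOn (norm ∘ V) (Metric.ball 0 1) 0 := by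
    intro t ht
    simp only [Set.mem_ofPred_eq, Function.comp]
    rw [hV0]
    exact disc_bound μ hμ q v hq hv hb (q 0) t ht
  letI := InnerProductSpace.rclikeToReal ℂ F
  have hsc : StrictConvexSpace ℝ F := inferInstance
  have hconst : Set.EqOn V (Function.const ℂ (V 0)) (Metric.ball 0 1) :=
    Complex.eqOn_of_isPreconnected_of_isMaxOn_norm (convex_ball _ _).isPreconnected
      Metric.isOpen_ball (diffOn_exp_inner _ _ hq hv) (by simp) hmax
  have hVt : ∀ t ∈ Metric.ball (0 : ℂ) 1,
      Real.exp (μ * (inner ℂ (q 0) (q t) : ℂ).re) * ‖v t‖ = Real.exp (μ * ‖q 0‖ ^ 2 / 2) := by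
    intro t ht
    have := congrArg norm (hconst ht)
    simp only [Function.const] at this
    rw [hV0] at this
    simp only [V] at this
    rwa [norm_smul, Complex.norm_exp, Complex.re_ofReal_mul] at this
  have hest : ∀ t ∈ Metric.ball (0 : ℂ) 1, t ≠ 0 →
      μ * ‖q t - q 0‖ ^ 2 ≤ μ * (1 - ‖t‖ ^ 2) * ‖q t‖ ^ 2 - 2 * Real.log ‖t‖ := by
    intro t ht t0
    have tp : 0 < ‖t‖ := norm_pos_iff.2 t0
    have h1 := hVt t ht
    have h2 := hb t ht
    have hvt : ‖v t‖ = Real.exp (μ * ‖q 0‖ ^ 2 / 2 - μ * (inner ℂ (q 0) (q t) : ℂ).re) := by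
      rw [Real.exp_sub, ← h1]; field_simp
    rw [norm_smul, norm_smul, hvt] at h2
    have h3 : (‖t‖ * Real.exp (μ * ‖q 0‖ ^ 2 / 2 - μ * (inner ℂ (q 0) (q t) : ℂ).re)) ^ 2
        = Real.exp (2 * (Real.log ‖t‖ + (μ * ‖q 0‖ ^ 2 / 2 - μ * (inner ℂ (q 0) (q t) : ℂ).re))) := by
      rw [two_mul, Real.exp_add, Real.exp_add, Real.exp_log tp]; ring
    rw [h3, Real.exp_le_exp] at h2
    have h4 := @norm_sub_sq ℂ E _ _ _ (q 0) (q t)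
    simp only [RCLike.re_eq_complex_re] at h4
    rw [norm_sub_rev, h4]
    nlinarith
  -- crude bound
  have hq0 : ∀ t ∈ Metric.ball (0 : ℂ) 1, q t = q 0 := by
    intro t ht
    have ht' : ‖t‖ < 1 := by simpa using ht
    have key : ∀ r : ℝ, ‖t‖ < r → r < 1 → 3 / 4 < r ^ 2 →
        ‖q t - q 0‖ ≤
          Real.sqrt ((μ * (1 - r ^ 2) * (2 * ‖q 0‖ ^ 2) - 2 * Real.log r) * 2 / μ) := by
      intro r hr hr1 hr2
      have hr0 : 0 < r := (norm_nonneg t).trans_lt hr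
      have hsub : Metric.closedBall (0 : ℂ) r ⊆ Metric.ball 0 1 := Metric.closedBall_subset_ball hr1
      refine Complex.norm_le_of_forall_mem_frontier_norm_le (U := Metric.ball (0 : ℂ) r)
        (f := fun t => q t - q 0)
        Metric.isBounded_ball ?_ ?_ (subset_closure (by simpa using hr))
      · refine DifferentiableOn.diffContOnCl ?_
        rw [closure_ball _ hr0.ne']
        exact (hq.sub_const _).mono hsub
      · intro x hx
        rw [frontier_ball _ hr0.ne'] at hx
        have hx' : ‖x‖ = r := by simpa using hx
        have hxe := hest x (by simp [hx', hr1]) (norm_pos_iff.1 (by rw [hx']; exact hr0))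
        rw [hx'] at hxe
        refine Real.le_sqrt_of_sq_le ?_
        rw [le_div_iff₀ hμ]
        have h5 : ‖q x‖ ^ 2 ≤ 2 * ‖q x - q 0‖ ^ 2 + 2 * ‖q 0‖ ^ 2 := by
          have : ‖q x‖ ≤ ‖q x - q 0‖ + ‖q 0‖ := by
            simpa using norm_add_le (q x - q 0) (q 0)
          nlinarith [norm_nonneg (q x), sq_nonneg (‖q x - q 0‖ - ‖q 0‖)]
        have h6 : 0 ≤ μ * (1 - r ^ 2) := by
          refine mul_nonneg hμ.le ?_
          nlinarith
        have h7 := mul_le_mul_of_nonneg_left h5 h6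
        have h8 : μ * (1 - r ^ 2) * ‖q x - q 0‖ ^ 2 ≤ μ * (1 / 4) * ‖q x - q 0‖ ^ 2 := by
          gcongr; linarith
        nlinarith
    have T2 : Filter.Tendsto (fun r : ℝ =>
        Real.sqrt ((μ * (1 - r ^ 2) * (2 * ‖q 0‖ ^ 2) - 2 * Real.log r) * 2 / μ))
        (nhdsWithin 1 (Set.Iio 1)) (nhds
        (Real.sqrt ((μ * (1 - (1 : ℝ) ^ 2) * (2 * ‖q 0‖ ^ 2) - 2 * Real.log 1) * 2 / μ))) := by
      refine Filter.Tendsto.mono_left ?_ nhdsWithin_le_nhds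
      have : ContinuousAt (fun r : ℝ =>
        Real.sqrt ((μ * (1 - r ^ 2) * (2 * ‖q 0‖ ^ 2) - 2 * Real.log r) * 2 / μ)) 1 := by
        have := Real.continuousAt_log (one_ne_zero)
        fun_prop
      exact this
    have := ge_of_tendsto T2 (b := ‖q t - q 0‖) (by
      have c : ∀ᶠ r : ℝ in nhdsWithin 1 (Set.Iio 1), 3 / 4 < r ^ 2 := by
        refine Filter.Eventually.filter_mono nhdsWithin_le_nhds ?_
        exact ((continuous_pow 2).tendsto (1 : ℝ)).eventually (lt_mem_nhds (by norm_num))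
      filter_upwards [Ioo_mem_nhdsLT ht', c] with r hr hc
      exact key r hr.1 hr.2 hc)
    have h9 : ‖q t - q 0‖ ≤ 0 := by simpa using this
    exact sub_eq_zero.1 (norm_le_zero_iff.1 h9)
  intro t ht
  refine ⟨hq0 t ht, ?_⟩
  have := hconst ht
  simp only [Function.const, V] at this
  rw [hq0 t ht] at this
  exact smul_right_injective F (Complex.exp_ne_zero _) this

end Disc

section Dom

variable {n m n' m' : ℕ} {μ μ' : ℝ}

lemma FBH_isOpen : IsOpen (FBH n m μ) := by
  unfold FBH
  refine isOpen_lt ?_ ?_ <;> fun_prop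

lemma FBH_zero : (0 : EuclideanSpace ℂ (Fin n) × EuclideanSpace ℂ (Fin m)) ∈ FBH n m μ := by
  simp [FBH]

lemma FBH_smul (hμ : 0 < μ) {p : EuclideanSpace ℂ (Fin n) × EuclideanSpace ℂ (Fin m)}
    (hp : ‖p.2‖ ^ 2 ≤ Real.exp (-μ * ‖p.1‖ ^ 2)) {t : ℂ} (ht : t ∈ Metric.ball (0 : ℂ) 1) :
    t • p ∈ FBH n m μ := by
  have ht' : ‖t‖ < 1 := by simpa using ht
  have ht2 : ‖t‖ ^ 2 < 1 := by nlinarith [norm_nonneg t]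
  simp only [FBH, Set.mem_ofPred_eq, Prod.smul_fst, Prod.smul_snd, norm_smul]
  have e := Real.exp_pos (-μ * ‖p.1‖ ^ 2)
  calc (‖t‖ * ‖p.2‖) ^ 2 = ‖t‖ ^ 2 * ‖p.2‖ ^ 2 := by ring
    _ ≤ ‖t‖ ^ 2 * Real.exp (-μ * ‖p.1‖ ^ 2) := by gcongr
    _ < Real.exp (-μ * ‖p.1‖ ^ 2) := by nlinarith
    _ ≤ _ := by
      rw [Real.exp_le_exp, mul_pow]
      have : 0 ≤ μ * ‖p.1‖ ^ 2 := by positivity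
      nlinarith

lemma disc_exists
    (f : EuclideanSpace ℂ (Fin n) × EuclideanSpace ℂ (Fin m) →
      EuclideanSpace ℂ (Fin n') × EuclideanSpace ℂ (Fin m'))
    (hf : DifferentiableOn ℂ f (FBH n m μ)) (h0 : f 0 = 0)
    (p : EuclideanSpace ℂ (Fin n) × EuclideanSpace ℂ (Fin m))
    (hp : ∀ t ∈ Metric.ball (0 : ℂ) 1, t • p ∈ FBH n m μ) :
    ∃ (q : ℂ → EuclideanSpace ℂ (Fin n')) (v : ℂ → EuclideanSpace ℂ (Fin m')),
      DifferentiableOn ℂ q (Metric.ball 0 1) ∧ DifferentiableOn ℂ v (Metric.ball 0 1) ∧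
      q 0 = (fderiv ℂ f 0 p).1 ∧ v 0 = (fderiv ℂ f 0 p).2 ∧ ∀ t, f (t • p) = t • (q t, v t) := by
  let h : ℂ → EuclideanSpace ℂ (Fin n') × EuclideanSpace ℂ (Fin m') := fun t => f (t • p)
  have hh : DifferentiableOn ℂ h (Metric.ball 0 1) :=
    hf.comp (by fun_prop) hp
  have hd : DifferentiableOn ℂ (dslope h 0) (Metric.ball 0 1) :=
    (Complex.differentiableOn_dslope (Metric.ball_mem_nhds _ one_pos)).2 hh
  have hder : dslope h 0 0 = fderiv ℂ f 0 p := by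
    rw [dslope_same]
    have h1 : HasFDerivAt f (fderiv ℂ f 0) ((0 : ℂ) • p) := by
      rw [zero_smul]
      exact (hf.differentiableAt (FBH_isOpen.mem_nhds FBH_zero)).hasFDerivAt
    have h2 : HasDerivAt (fun t : ℂ => t • p) p 0 := by
      simpa using (hasDerivAt_id (0 : ℂ)).smul_const p
    exact (h1.comp_hasDerivAt (0 : ℂ) h2).deriv
  refine ⟨fun t => (dslope h 0 t).1, fun t => (dslope h 0 t).2, hd.fst, hd.snd, ?_, ?_, ?_⟩
  · simp only [hder]
  · simp only [hder]
  · intro t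
    have := sub_smul_dslope h 0 t
    simp only [sub_zero] at this
    change f (t • p) = t • dslope h 0 t
    rw [this]
    simp [h, h0]

lemma linear_maps (hμ : 0 < μ) (hμ' : 0 < μ')
    (f : EuclideanSpace ℂ (Fin n) × EuclideanSpace ℂ (Fin m) →
      EuclideanSpace ℂ (Fin n') × EuclideanSpace ℂ (Fin m'))
    (hf : DifferentiableOn ℂ f (FBH n m μ)) (h0 : f 0 = 0)
    (hmaps : Set.MapsTo f (FBH n m μ) (FBH n' m' μ')) :
    Set.MapsTo (fderiv ℂ f 0) (FBH n m μ) (FBH n' m' μ') := by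
  intro p hp
  obtain ⟨c, hc1, hc⟩ : ∃ c : ℝ, 1 < c ∧ (c : ℂ) • p ∈ FBH n m μ := by
    have hcont : Continuous (fun c : ℝ => (c : ℂ) • p) := by fun_prop
    have : ∀ᶠ c : ℝ in nhds (1 : ℝ), ((c : ℝ) : ℂ) • p ∈ FBH n m μ :=
      hcont.continuousAt.eventually_mem (x := (1 : ℝ)) (FBH_isOpen.mem_nhds (by
        rw [Complex.ofReal_one, one_smul]; exact hp))
    have h2 := (this.filter_mono (nhdsWithin_le_nhds (s := Set.Ioi 1))).and self_mem_nhdsWithin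
    obtain ⟨c, h, h'⟩ := h2.exists
    exact ⟨c, h', h⟩
  obtain ⟨q, v, hq, hv, hq0, hv0, hfq⟩ := disc_exists f hf h0 ((c : ℂ) • p)
    (fun t ht => FBH_smul hμ (le_of_lt hc) ht)
  have := disc_zero μ' hμ' q v hq hv (by
    intro t ht
    have h1 := hmaps (FBH_smul hμ (le_of_lt hc) ht)
    rw [hfq] at h1
    exact le_of_lt h1)
  rw [hq0, hv0, map_smul, Prod.smul_fst, Prod.smul_snd, norm_smul, norm_smul,
    Complex.norm_real, Real.norm_of_nonneg (by linarith)] at this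
  have hc0 : 0 < c⁻¹ := by positivity
  have hm : c⁻¹ < 1 := inv_lt_one_of_one_lt₀ hc1
  have h3 := FBH_smul (n := n') (m := m') (p := (c : ℂ) • fderiv ℂ f 0 p) (t := ((c⁻¹ : ℝ) : ℂ)) hμ'
    (by
      rw [Prod.smul_fst, Prod.smul_snd, norm_smul, norm_smul,
        Complex.norm_real, Real.norm_of_nonneg (by linarith)]
      exact this)
    (by
      rw [mem_ball_zero_iff, Complex.norm_real, Real.norm_of_nonneg hc0.le]; exact hm)
  rwa [smul_smul, ← Complex.ofReal_mul, inv_mul_cancel₀ (by linarith), Complex.ofReal_one,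
    one_smul] at h3

lemma cartan (hμ : 0 < μ) (hm : 0 < m)
    (f : EuclideanSpace ℂ (Fin n) × EuclideanSpace ℂ (Fin m) →
      EuclideanSpace ℂ (Fin n) × EuclideanSpace ℂ (Fin m))
    (hf : DifferentiableOn ℂ f (FBH n m μ)) (h0 : f 0 = 0)
    (hmaps : Set.MapsTo f (FBH n m μ) (FBH n m μ))
    (hd : ∀ p, fderiv ℂ f 0 p = p) :
    ∀ p ∈ FBH n m μ, f p = p := by
  have main : ∀ p ∈ FBH n m μ, p.2 ≠ 0 → f p = p := by
    intro p hp hp2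
    have hpos : 0 < ‖p.2‖ := norm_pos_iff.2 hp2
    have hp' : ‖p.2‖ ^ 2 < Real.exp (-μ * ‖p.1‖ ^ 2) := hp
    have hle1 : ‖p.2‖ < 1 := by
      have : Real.exp (-μ * ‖p.1‖ ^ 2) ≤ 1 := by
        rw [Real.exp_le_one_iff]
        have : 0 ≤ μ * ‖p.1‖ ^ 2 := by positivity
        linarith
      nlinarith
    have hinv : 1 ≤ ‖p.2‖⁻¹ := (one_le_inv₀ hpos).2 hle1.le
    let φ : ℝ → ℝ := fun c => (c * ‖p.2‖) ^ 2 - Real.exp (-μ * (c * ‖p.1‖) ^ 2)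
    have hφ : ContinuousOn φ (Set.Icc 1 ‖p.2‖⁻¹) := by
      apply Continuous.continuousOn; fun_prop
    have hφ1 : φ 1 < 0 := by simp only [φ, one_mul]; linarith
    have hφ2 : 0 ≤ φ ‖p.2‖⁻¹ := by
      simp only [φ]
      rw [inv_mul_cancel₀ hpos.ne', one_pow, sub_nonneg, Real.exp_le_one_iff]
      have : 0 ≤ μ * (‖p.2‖⁻¹ * ‖p.1‖) ^ 2 := by positivity
      linarith
    obtain ⟨c, ⟨hc1, -⟩, hc⟩ := intermediate_value_Icc hinv hφ ⟨hφ1.le, hφ2⟩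
    have hc1' : 1 < c := lt_of_le_of_ne hc1 (by rintro rfl; linarith)
    have hceq : ‖((c : ℂ) • p).2‖ ^ 2 = Real.exp (-μ * ‖((c : ℂ) • p).1‖ ^ 2) := by
      rw [Prod.smul_fst, Prod.smul_snd, norm_smul, norm_smul,
        Complex.norm_real, Real.norm_of_nonneg (by linarith)]
      simp only [φ] at hc
      linarith
    obtain ⟨q, v, hq, hv, hq0, hv0, hfq⟩ := disc_exists f hf h0 ((c : ℂ) • p)
      (fun t ht => FBH_smul hμ hceq.le ht)
    rw [hd] at hq0 hv0
    have hr := disc_rigid μ hμ q v hq hv (by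
      intro t ht
      have h1 := hmaps (FBH_smul hμ hceq.le ht)
      rw [hfq] at h1
      exact le_of_lt h1) (by rw [hq0, hv0]; exact hceq)
    have hc0 : 0 < c⁻¹ := by positivity
    have hm : c⁻¹ < 1 := inv_lt_one_of_one_lt₀ hc1'
    obtain ⟨e1, e2⟩ := hr ((c⁻¹ : ℝ) : ℂ) (by
      rw [mem_ball_zero_iff, Complex.norm_real, Real.norm_of_nonneg hc0.le]; exact hm)
    have e3 := hfq ((c⁻¹ : ℝ) : ℂ)
    rw [e1, e2, hq0, hv0, Prod.mk.eta, smul_smul, ← Complex.ofReal_mul,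
      inv_mul_cancel₀ (by linarith), Complex.ofReal_one, one_smul] at e3
    exact e3
  intro p hp
  by_cases hp2 : p.2 = 0
  · let u : EuclideanSpace ℂ (Fin n) × EuclideanSpace ℂ (Fin m) :=
      (0, EuclideanSpace.single ⟨0, hm⟩ 1)
    have hu : u.2 ≠ 0 := by simp [u]
    have T : Filter.Tendsto (fun s : ℂ => p + s • u) (nhdsWithin 0 {0}ᶜ) (nhds p) := by
      have : Continuous (fun s : ℂ => p + s • u) := by fun_prop
      simpa using (this.tendsto 0).mono_left (nhdsWithin_le_nhds (s := {0}ᶜ))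
    have hfc : ContinuousAt f p := (hf.differentiableAt (FBH_isOpen.mem_nhds hp)).continuousAt
    have T2 := hfc.tendsto.comp T
    refine tendsto_nhds_unique (T2.congr' ?_) T
    filter_upwards [T.eventually_mem (FBH_isOpen.mem_nhds hp), self_mem_nhdsWithin] with s hs hs0
    refine main _ hs ?_
    rw [Prod.snd_add, hp2, zero_add, Prod.smul_snd]
    exact smul_ne_zero hs0 hu
  · exact main p hp hp2

end Dom

/-- Cartan-type theorem: a biholomorphism between equidimensional
Fock–Bargmann–Hartogs domains fixing the origin is linear. -/
theorem biholomorphism_fixing_origin_is_linear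
    (n m n' m' : ℕ) (hn : 0 < n) (hm : 0 < m) (hn' : 0 < n') (hm' : 0 < m')
    (hdim : n + m = n' + m') (μ μ' : ℝ) (hμ : 0 < μ) (hμ' : 0 < μ')
    (f : EuclideanSpace ℂ (Fin n) × EuclideanSpace ℂ (Fin m) →
      EuclideanSpace ℂ (Fin n') × EuclideanSpace ℂ (Fin m'))
    (g : EuclideanSpace ℂ (Fin n') × EuclideanSpace ℂ (Fin m') →
      EuclideanSpace ℂ (Fin n) × EuclideanSpace ℂ (Fin m))
    (hf : DifferentiableOn ℂ f (FBH n m μ))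
    (hg : DifferentiableOn ℂ g (FBH n' m' μ'))
    (hfmaps : Set.MapsTo f (FBH n m μ) (FBH n' m' μ'))
    (hgmaps : Set.MapsTo g (FBH n' m' μ') (FBH n m μ))
    (hgf : ∀ x ∈ FBH n m μ, g (f x) = x)
    (hfg : ∀ y ∈ FBH n' m' μ', f (g y) = y)
    (h0 : f (0, 0) = (0, 0)) :
    ∃ L : (EuclideanSpace ℂ (Fin n) × EuclideanSpace ℂ (Fin m)) →ₗ[ℂ]
        (EuclideanSpace ℂ (Fin n') × EuclideanSpace ℂ (Fin m')),
      ∀ x ∈ FBH n m μ, f x = L x := by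
  have f0 : f 0 = 0 := h0
  have g0 : g 0 = 0 := by
    have := hgf 0 FBH_zero
    rwa [f0] at this
  have df : DifferentiableAt ℂ f 0 := hf.differentiableAt (FBH_isOpen.mem_nhds FBH_zero)
  have dg : DifferentiableAt ℂ g 0 := hg.differentiableAt (FBH_isOpen.mem_nhds FBH_zero)
  have hML : ∀ p, fderiv ℂ g 0 (fderiv ℂ f 0 p) = p := by
    have h1 : HasFDerivAt (g ∘ f) ((fderiv ℂ g 0).comp (fderiv ℂ f 0)) 0 :=
      HasFDerivAt.comp 0 (by rw [f0]; exact dg.hasFDerivAt) df.hasFDerivAt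
    have h2 : HasFDerivAt (g ∘ f) (ContinuousLinearMap.id ℂ _) 0 :=
      (hasFDerivAt_id _).congr_of_eventuallyEq (by
        filter_upwards [FBH_isOpen.mem_nhds FBH_zero] with x hx using hgf x hx)
    intro p
    exact congrArg (fun A => A p) (h1.unique h2)
  have hLM : ∀ p, fderiv ℂ f 0 (fderiv ℂ g 0 p) = p := by
    have h1 : HasFDerivAt (f ∘ g) ((fderiv ℂ f 0).comp (fderiv ℂ g 0)) 0 :=
      HasFDerivAt.comp 0 (by rw [g0]; exact df.hasFDerivAt) dg.hasFDerivAt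
    have h2 : HasFDerivAt (f ∘ g) (ContinuousLinearMap.id ℂ _) 0 :=
      (hasFDerivAt_id _).congr_of_eventuallyEq (by
        filter_upwards [FBH_isOpen.mem_nhds FBH_zero] with x hx using hfg x hx)
    intro p
    exact congrArg (fun A => A p) (h1.unique h2)
  have hM := linear_maps hμ' hμ g hg g0 hgmaps
  have key := cartan hμ hm (fun x => fderiv ℂ g 0 (f x))
    ((fderiv ℂ g 0).differentiable.comp_differentiableOn hf) (by simp [f0])
    (fun x hx => hM (hfmaps hx)) (by
      intro p
      have : HasFDerivAt (fun x => fderiv ℂ g 0 (f x)) ((fderiv ℂ g 0).comp (fderiv ℂ f 0)) 0 :=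
        (fderiv ℂ g 0).hasFDerivAt.comp 0 df.hasFDerivAt
      rw [this.fderiv]
      exact hML p)
  refine ⟨(fderiv ℂ f 0).toLinearMap, fun x hx => ?_⟩
  have := congrArg (fderiv ℂ f 0) (key x hx)
  rw [hLM] at this
  exact this
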